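/- Let n ≥ 1, let J be a finite set, and let φ : Fin n → J be a surjection with parts I_j := φ⁻¹(j); for i ≥ 1 set K_i := {j ∈ J : |I_j| = i}. Consider the subspace Ũ := {x : Fin n → ℂ : x_a = x_b whenever φ(a) = φ(b)} of ℂⁿ, on which the symmetric group Perm(Fin n) acts by (σ·x)_a = x_{σ⁻¹(a)}. Then the setwise stabiliser Stab(Ũ) := {σ ∈ Perm(Fin n) : σ·Ũ = Ũ} equals the subgroup of permutations that permute the parts, {σ : for every j ∈ J there is j′ ∈ J with σ(I_j) = I_{j′}}, and this subgroup is isomorphic to the direct product over i ≥ 1 of the wreath products Perm(K_i) ≀ Perm(Fin i), i.e. to ∏_{i ≥ 1} (Perm(K_i) ⋉ (K_i → Perm(Fin i))) where Perm(K_i) acts on the function group by permuting coordinates. The same conclusions hold for the setwise stabiliser of U := Ũ ∩ {x : Σ_a x_a = 0}. -/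

import Mathlib

/-- The multiplicative automorphism of the direct product group `K → G` given by
permuting coordinates along `σ ∈ Perm K`: `(σ · f) k = f (σ⁻¹ k)`. -/
def coordPermEquiv {K G : Type*} [Group G] (σ : Equiv.Perm K) : (K → G) ≃* (K → G) where
  toFun f := f ∘ ⇑σ.symm
  invFun f := f ∘ ⇑σ
  left_inv f := by ext k; simp
  right_inv f := by ext k; simp
  map_mul' f g := rfl

/-- The action of `Perm K` on the direct product group `K → G` by permuting
coordinates, as a homomorphism to the automorphism group. -/
def coordPermAut {K G : Type*} [Group G] : Equiv.Perm K →* MulAut (K → G) where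
  toFun := coordPermEquiv
  map_one' := by ext f k; rfl
  map_mul' σ τ := by ext f k; rfl

/-- `σ` preserves the partition of `X` into the fibres of `φ`. -/
def PreservesFibers {X J : Type*} (φ : X → J) (σ : Equiv.Perm X) : Prop :=
  ∀ a b, φ (σ a) = φ (σ b) ↔ φ a = φ b

section PreservesFibers

variable {X J : Type*} {φ : X → J} {σ : Equiv.Perm X}

theorem PreservesFibers.image_preimage (h : PreservesFibers φ σ) (a : X) :
    σ '' (φ ⁻¹' {φ a}) = φ ⁻¹' {φ (σ a)} := by
  ext b
  constructor
  · rintro ⟨c, hc, rfl⟩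
    exact (h c a).2 hc
  · intro hb
    refine ⟨σ.symm b, (h _ _).1 ?_, by simp⟩
    simpa using hb

theorem preservesFibers_iff_image_preimage (hφ : Function.Surjective φ) :
    PreservesFibers φ σ ↔ ∀ j, ∃ j', σ '' (φ ⁻¹' {j}) = φ ⁻¹' {j'} := by
  constructor
  · intro h j
    obtain ⟨a, rfl⟩ := hφ j
    exact ⟨_, h.image_preimage a⟩
  · intro h a b
    obtain ⟨j', hj'⟩ := h (φ b)
    have key (c : X) : φ (σ c) = j' ↔ φ c = φ b := by
      have := Set.ext_iff.1 hj' (σ c)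
      simpa using this.symm
    rw [(key b).2 rfl, key]

theorem PreservesFibers.card_preimage (h : PreservesFibers φ σ) (a : X) :
    Nat.card (φ ⁻¹' {φ (σ a)}) = Nat.card (φ ⁻¹' {φ a}) := by
  rw [← h.image_preimage a, Nat.card_image_of_injective σ.injective]

theorem preservesFibers_permCongr_iff {Y L : Type*} {ψ : Y → L} {E : X ≃ Y}
    (hE : ∀ a b, ψ (E a) = ψ (E b) ↔ φ a = φ b) :
    PreservesFibers ψ (E.permCongr σ) ↔ PreservesFibers φ σ := by
  constructor
  · intro h a b
    simpa [hE] using h (E a) (E b)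
  · intro h a b
    simpa [← hE] using h (E.symm a) (E.symm b)

end PreservesFibers

section Stabilizer

variable {X J : Type*} {φ : X → J} {σ : Equiv.Perm X}

theorem image_comp_symm_eq_iff {R : Type*} (S : Set (X → R)) :
    (fun x : X → R => x ∘ σ.symm) '' S = S ↔ ∀ x, x ∘ σ ∈ S ↔ x ∈ S := by
  have key : (fun x : X → R => x ∘ σ.symm) '' S = {x | x ∘ σ ∈ S} := by
    ext x
    constructor
    · rintro ⟨y, hy, rfl⟩
      simpa [Function.comp_assoc] using hy
    · intro hx
      exact ⟨_, hx, by simp [Function.comp_assoc]⟩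
  rw [key, Set.ext_iff]
  rfl

theorem comp_mem_fiberConst_iff {R : Type*} [Nontrivial R] :
    (∀ x : X → R, (∀ a b, φ a = φ b → (x ∘ σ) a = (x ∘ σ) b) ↔ ∀ a b, φ a = φ b → x a = x b) ↔
      PreservesFibers φ σ := by
  classical
  obtain ⟨r, s, hrs⟩ := exists_pair_ne R
  constructor
  · intro h a b
    constructor
    · intro hab
      have h1 := (h fun c => if φ (σ.symm c) = φ b then r else s).1
        (fun c d hcd => by simp [hcd]) _ _ hab
      by_contra hne
      simp [hne, hrs.symm] at h1
    · intro hab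
      have h1 := (h fun c => if φ c = φ (σ b) then r else s).2
        (fun c d hcd => by simp [hcd]) _ _ hab
      by_contra hne
      simp [hne, hrs.symm] at h1
  · intro h x
    constructor
    · intro hx a b hab
      simpa using hx (σ.symm a) (σ.symm b) ((h _ _).1 (by simpa using hab))
    · intro hx a b hab
      exact hx _ _ ((h _ _).2 hab)

theorem comp_mem_fiberConst_sum_zero_iff [Fintype X] [Nonempty X] :
    (∀ x : X → ℂ, ((∀ a b, φ a = φ b → (x ∘ σ) a = (x ∘ σ) b) ∧ ∑ a, (x ∘ σ) a = 0) ↔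
      ((∀ a b, φ a = φ b → x a = x b) ∧ ∑ a, x a = 0)) ↔ PreservesFibers φ σ := by
  have hsum (x : X → ℂ) : ∑ a, (x ∘ σ) a = ∑ a, x a := Equiv.sum_comp σ x
  rw [← comp_mem_fiberConst_iff (R := ℂ)]
  constructor
  · intro h x
    set m : ℂ := (∑ a, x a) / Fintype.card X
    have hm : ∑ a, (x a - m) = 0 := by
      have : (Fintype.card X : ℂ) ≠ 0 := by simp
      simp only [Finset.sum_sub_distrib, Finset.sum_const, Finset.card_univ, nsmul_eq_mul, m]
      field_simp
      simp
    have := h fun a => x a - m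
    rw [hsum] at this
    simpa [hm] using this
  · intro h x
    rw [hsum, h]

end Stabilizer

section Wreath

variable (K F : Type*)

/-- The imprimitive action of the wreath product `Perm K ≀ Perm F` on `K × F`. -/
def wreathToPerm :
    ((K → Equiv.Perm F) ⋊[coordPermAut] Equiv.Perm K) →* Equiv.Perm (K × F) :=
  SemidirectProduct.lift
    { toFun := fun f => Equiv.prodShear (Equiv.refl K) f
      map_one' := rfl
      map_mul' := fun _ _ => rfl }
    { toFun := fun p => p.prodCongr (Equiv.refl F)
      map_one' := rfl
      map_mul' := fun _ _ => rfl }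
    (fun p => by
      ext f a
      · exact (p.apply_symm_apply a.1).symm
      · rfl)

variable {K F}

theorem wreathToPerm_apply (w : (K → Equiv.Perm F) ⋊[coordPermAut] Equiv.Perm K) (a : K × F) :
    wreathToPerm K F w a = (w.right a.1, w.left (w.right a.1) a.2) := rfl

theorem wreathToPerm_injective [Nonempty F] : Function.Injective (wreathToPerm K F) := by
  intro v w h
  have key (k : K) (x : F) := DFunLike.congr_fun h (k, x)
  simp only [wreathToPerm_apply, Prod.mk.injEq] at key
  have hr : v.right = w.right := by
    ext k
    exact (key k (Classical.arbitrary F)).1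
  refine SemidirectProduct.ext ?_ hr
  ext k x
  have := (key (w.right.symm k) x).2
  simpa [hr] using this

theorem exists_wreathToPerm_eq [Finite K] [Finite F] [Nonempty F] {τ : Equiv.Perm (K × F)}
    (hτ : PreservesFibers Prod.fst τ) : ∃ w, wreathToPerm K F w = τ := by
  have x₀ : F := Classical.arbitrary F
  have hp : Function.Injective fun k => (τ (k, x₀)).1 := fun k l h => (hτ _ _).1 h
  let p : Equiv.Perm K := Equiv.ofBijective _ (Finite.injective_iff_bijective.1 hp)
  have hpτ (k : K) (x : F) : (τ (k, x)).1 = p k := (hτ _ _).2 rfl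
  have hf (k : K) : Function.Injective fun x => (τ (p.symm k, x)).2 := by
    intro x y h
    have : τ (p.symm k, x) = τ (p.symm k, y) := Prod.ext (by simp [hpτ]) h
    simpa using this
  refine ⟨⟨fun k => Equiv.ofBijective _ (Finite.injective_iff_bijective.1 (hf k)), p⟩, ?_⟩
  ext a
  · simp [wreathToPerm_apply, ← hpτ a.1 a.2]
  · simp [wreathToPerm_apply]

theorem preservesFibers_wreathToPerm
    (w : (K → Equiv.Perm F) ⋊[coordPermAut] Equiv.Perm K) :
    PreservesFibers Prod.fst (wreathToPerm K F w) := by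
  intro a b
  simp [wreathToPerm_apply]

end Wreath

section SigmaBlocks

variable {I : Type*} (K F : I → Type*)

/-- The product of the imprimitive actions of the wreath products `Perm (K i) ≀ Perm (F i)`, acting
on the disjoint union of the `K i × F i`. -/
def piWreathToPerm :
    (∀ i, (K i → Equiv.Perm (F i)) ⋊[coordPermAut] Equiv.Perm (K i)) →*
      Equiv.Perm (Σ i, K i × F i) :=
  (Equiv.Perm.sigmaCongrRightHom fun i => K i × F i).comp
    (MonoidHom.pi fun i => (wreathToPerm (K i) (F i)).comp (Pi.evalMonoidHom _ i))

variable {K F}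

theorem piWreathToPerm_apply
    (w : ∀ i, (K i → Equiv.Perm (F i)) ⋊[coordPermAut] Equiv.Perm (K i)) (a : Σ i, K i × F i) :
    piWreathToPerm K F w a = ⟨a.1, wreathToPerm (K a.1) (F a.1) (w a.1) a.2⟩ := rfl

theorem piWreathToPerm_injective [∀ i, Nonempty (F i)] :
    Function.Injective (piWreathToPerm K F) := by
  intro v w h
  have := Equiv.Perm.sigmaCongrRightHom_injective h
  funext i
  exact wreathToPerm_injective (congrFun this i)

/-- The block of the disjoint union of the `K i × F i` containing a given point. -/
def sigmaBlock (a : Σ i, K i × F i) : Σ i, K i := ⟨a.1, a.2.1⟩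

theorem preservesFibers_piWreathToPerm
    (w : ∀ i, (K i → Equiv.Perm (F i)) ⋊[coordPermAut] Equiv.Perm (K i)) :
    PreservesFibers sigmaBlock (piWreathToPerm K F w) := by
  rintro ⟨i, a⟩ ⟨j, b⟩
  by_cases hij : i = j
  · subst hij
    simpa [sigmaBlock, piWreathToPerm_apply] using preservesFibers_wreathToPerm (w i) a b
  · simp [sigmaBlock, piWreathToPerm_apply, hij]

theorem exists_piWreathToPerm_eq [∀ i, Finite (K i)] [∀ i, Finite (F i)] [∀ i, Nonempty (F i)]
    {τ : Equiv.Perm (Σ i, K i × F i)} (hτ : PreservesFibers sigmaBlock τ)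
    (hfst : ∀ a, (τ a).1 = a.1) : ∃ w, piWreathToPerm K F w = τ := by
  have hex (i : I) (a : K i × F i) : ∃ b : K i × F i, τ ⟨i, a⟩ = ⟨i, b⟩ := by
    have h := hfst ⟨i, a⟩
    generalize τ ⟨i, a⟩ = c at h
    obtain ⟨j, c⟩ := c
    obtain rfl : j = i := h
    exact ⟨c, rfl⟩
  choose g hg using hex
  have hinj (i : I) : Function.Injective (g i) := by
    intro a b hab
    have : τ ⟨i, a⟩ = τ ⟨i, b⟩ := by rw [hg, hg, hab]
    simpa using this
  have hw (i : I) : ∃ w, wreathToPerm (K i) (F i) w =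
      Equiv.ofBijective (g i) (Finite.injective_iff_bijective.1 (hinj i)) := by
    refine exists_wreathToPerm_eq fun a b => ?_
    have := hτ ⟨i, a⟩ ⟨i, b⟩
    rw [hg, hg] at this
    simpa [sigmaBlock] using this
  choose w hw using hw
  refine ⟨w, Equiv.ext fun ⟨i, a⟩ => ?_⟩
  rw [piWreathToPerm_apply, hw, hg]
  rfl

end SigmaBlocks

section Enumeration

variable {X J : Type*} [Finite X] (φ : X → J)

/-- An identification of `X` with the disjoint union, over `i ≥ 1`, of `K i × Fin i` where `K i` is
the set of labels of the fibres of `φ` having `i` elements. -/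
theorem exists_sigma_equiv :
    ∃ E : (Σ i : {i : ℕ // 1 ≤ i}, {j : J // Nat.card (φ ⁻¹' {j}) = (i : ℕ)} × Fin (i : ℕ)) ≃ X,
      ∀ a, φ (E a) = a.2.1 := by
  let e (i : {i : ℕ // 1 ≤ i}) (k : {j : J // Nat.card (φ ⁻¹' {j}) = (i : ℕ)}) :
      φ ⁻¹' {k.1} ≃ Fin (i : ℕ) := Finite.equivFinOfCardEq k.2
  let g : (Σ i : {i : ℕ // 1 ≤ i}, {j : J // Nat.card (φ ⁻¹' {j}) = (i : ℕ)} × Fin (i : ℕ)) → X :=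
    fun a => ((e a.1 a.2.1).symm a.2.2).1
  have hg (a) : φ (g a) = a.2.1 := ((e a.1 a.2.1).symm a.2.2).2
  refine ⟨Equiv.ofBijective g ⟨?_, ?_⟩, hg⟩
  · rintro ⟨i, k, x⟩ ⟨i', k', x'⟩ h
    have hk : k.1 = k'.1 := by rw [← hg ⟨i, k, x⟩, ← hg ⟨i', k', x'⟩, h]
    obtain rfl : i = i' := Subtype.ext (by rw [← k.2, ← k'.2, hk])
    obtain rfl : k = k' := Subtype.ext hk
    have : x = x' := (e i k).symm.injective (Subtype.ext h)
    rw [this]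
  · intro a
    have : Nonempty (φ ⁻¹' {φ a}) := ⟨⟨a, rfl⟩⟩
    let i : {i : ℕ // 1 ≤ i} := ⟨Nat.card (φ ⁻¹' {φ a}), Nat.card_pos⟩
    let k : {j : J // Nat.card (φ ⁻¹' {j}) = (i : ℕ)} := ⟨φ a, rfl⟩
    exact ⟨⟨i, k, e i k ⟨a, rfl⟩⟩, congrArg Subtype.val ((e i k).symm_apply_apply ⟨a, rfl⟩)⟩

/-- A subgroup of `Perm X` consisting of the permutations that preserve the partition into fibres of
`φ` is a product of wreath products. -/
theorem nonempty_mulEquiv_pi_wreath [Finite J] (P : Subgroup (Equiv.Perm X))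
    (hP : ∀ σ, σ ∈ P ↔ PreservesFibers φ σ) :
    Nonempty (P ≃* ∀ i : {i : ℕ // 1 ≤ i},
      (({j : J // Nat.card (φ ⁻¹' {j}) = (i : ℕ)} → Equiv.Perm (Fin (i : ℕ)))
        ⋊[coordPermAut] Equiv.Perm {j : J // Nat.card (φ ⁻¹' {j}) = (i : ℕ)})) := by
  obtain ⟨E, hE⟩ := exists_sigma_equiv φ
  have (i : {i : ℕ // 1 ≤ i}) : Nonempty (Fin (i : ℕ)) := ⟨⟨0, i.2⟩⟩
  have hblock (a b) : φ (E a) = φ (E b) ↔ sigmaBlock a = sigmaBlock b := by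
    obtain ⟨i, k, x⟩ := a
    obtain ⟨i', k', x'⟩ := b
    rw [hE, hE]
    constructor
    · intro (hk : k.1 = k'.1)
      obtain rfl : i = i' := Subtype.ext (by rw [← k.2, ← k'.2, hk])
      obtain rfl : k = k' := Subtype.ext hk
      rfl
    · intro h
      obtain ⟨rfl, h⟩ := Sigma.mk.inj_iff.1 h
      exact congrArg Subtype.val (eq_of_heq h)
  have hpres (τ) := preservesFibers_permCongr_iff (σ := τ) hblock
  let Θ := E.permCongrHom.toMonoidHom.comp
    (piWreathToPerm (fun i : {i : ℕ // 1 ≤ i} => {j : J // Nat.card (φ ⁻¹' {j}) = (i : ℕ)})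
      fun i => Fin (i : ℕ))
  have hΘ : Function.Injective Θ := E.permCongrHom.injective.comp piWreathToPerm_injective
  have hrange : Θ.range = P := by
    ext σ
    rw [hP]
    constructor
    · rintro ⟨w, rfl⟩
      exact (hpres _).2 (preservesFibers_piWreathToPerm w)
    · intro h
      obtain ⟨τ, rfl⟩ := E.permCongr.surjective σ
      obtain ⟨w, hw⟩ := exists_piWreathToPerm_eq ((hpres τ).1 h) fun a => by
        have hcard := h.card_preimage (E a)
        rw [Equiv.permCongr_apply, Equiv.symm_apply_apply, hE, hE, (τ a).2.1.2, a.2.1.2] at hcard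
        exact Subtype.ext hcard
      exact ⟨w, congrArg E.permCongr hw⟩
  exact ⟨((MonoidHom.ofInjective hΘ).trans (MulEquiv.subgroupCongr hrange)).symm⟩

end Enumeration

/-- Let `φ : Fin n → J` be a surjection with parts `I_j = φ⁻¹ {j}` and, for `i ≥ 1`,
`K_i = {j ∈ J : |I_j| = i}`.  Consider the subspace
`Ũ = {x : Fin n → ℂ : x_a = x_b whenever φ a = φ b}` of `ℂⁿ`, on which `Perm (Fin n)`
acts by `(σ · x) a = x (σ⁻¹ a)`.  Then the setwise stabiliser of `Ũ` equals the
subgroup `P` of permutations permuting the parts, `P` is isomorphic to the direct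
product over `i ≥ 1` of the wreath products `Perm (K_i) ≀ Perm (Fin i)` (realised as
semidirect products `(K_i → Perm (Fin i)) ⋊ Perm (K_i)` for the coordinate-permuting
action), and the same holds for the setwise stabiliser of `U = Ũ ∩ {Σ x_a = 0}`. -/
theorem stmt_7 {n : ℕ} (hn : 1 ≤ n) {J : Type*} [Fintype J] [DecidableEq J]
    (φ : Fin n → J) (hφ : Function.Surjective φ)
    (Ut : Set (Fin n → ℂ))
    (hUt : Ut = {x : Fin n → ℂ | ∀ a b : Fin n, φ a = φ b → x a = x b})
    (U : Set (Fin n → ℂ)) (hU : U = Ut ∩ {x : Fin n → ℂ | ∑ a, x a = 0})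
    (P : Subgroup (Equiv.Perm (Fin n)))
    (hP : (P : Set (Equiv.Perm (Fin n)))
        = {σ : Equiv.Perm (Fin n) |
            ∀ j : J, ∃ j' : J, ⇑σ '' (φ ⁻¹' {j}) = φ ⁻¹' {j'}}) :
    {σ : Equiv.Perm (Fin n) | (fun x : Fin n → ℂ => x ∘ ⇑σ.symm) '' Ut = Ut}
        = (P : Set (Equiv.Perm (Fin n))) ∧
      {σ : Equiv.Perm (Fin n) | (fun x : Fin n → ℂ => x ∘ ⇑σ.symm) '' U = U}
        = (P : Set (Equiv.Perm (Fin n))) ∧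
      Nonempty (P ≃* ∀ i : {i : ℕ // 1 ≤ i},
        (({j : J // Nat.card (φ ⁻¹' {j}) = (i : ℕ)} → Equiv.Perm (Fin (i : ℕ)))
          ⋊[coordPermAut] Equiv.Perm {j : J // Nat.card (φ ⁻¹' {j}) = (i : ℕ)})) := by
  have : Nonempty (Fin n) := ⟨⟨0, hn⟩⟩
  have hmem (σ : Equiv.Perm (Fin n)) : σ ∈ P ↔ PreservesFibers φ σ := by
    rw [← SetLike.mem_coe, hP, preservesFibers_iff_image_preimage hφ]
    rfl
  refine ⟨?_, ?_, nonempty_mulEquiv_pi_wreath φ P hmem⟩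
  · ext σ
    rw [SetLike.mem_coe, hmem, ← comp_mem_fiberConst_iff (R := ℂ), Set.mem_ofPred_eq,
      image_comp_symm_eq_iff, hUt]
    rfl
  · ext σ
    rw [SetLike.mem_coe, hmem, ← comp_mem_fiberConst_sum_zero_iff, Set.mem_ofPred_eq,
      image_comp_symm_eq_iff, hU, hUt]
    rfl
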